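/- arXiv:0812.4480 — 4 statements merged into one kernel-verified Lean document; each statement's English description precedes it below -/
import Mathlib

section
/- Under the stated hypotheses, the range of f − id is a linear complement of W in V: W ∩ range(f − id) = {0} and W + range(f − id) = V (IsCompl W (range (f − id))). -/
/-- Fiberwise content of the decomposition `TM ⊕ E = M ×_X TX` (Proposition 4.4):
the range of `f - id` is a linear complement of `W` in `V`. -/
theorem stmt3 (V : Type*) [AddCommGroup V] [Module ℝ V] [FiniteDimensional ℝ V]
    (f : V →ₗ[ℝ] V) (W : Submodule ℝ V) (hW : ∀ w ∈ W, f w = w)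
    (hbar : ∀ v : V ⧸ W,
      Submodule.mapQ W W f
        (fun w hw => Submodule.mem_comap.mpr (by rw [hW w hw]; exact hw)) v = v →
      v = 0) :
    IsCompl W (LinearMap.range (f - LinearMap.id)) := by
  have key : ∀ v, f v - v ∈ W → v ∈ W := by
    intro v hv
    rw [← Submodule.Quotient.mk_eq_zero W]
    apply hbar
    rw [Submodule.mapQ_apply]
    exact (Submodule.Quotient.eq W).mpr hv
  constructor
  · rw [Submodule.disjoint_def]
    rintro x hx ⟨v, rfl⟩
    have hv : v ∈ W := key v (by simpa using hx)
    simp [hW v hv]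
  · rw [codisjoint_iff, eq_top_iff]
    intro v _
    let g : V ⧸ W →ₗ[ℝ] V ⧸ W := Submodule.mapQ W W f
      (fun w hw => Submodule.mem_comap.mpr (by rw [hW w hw]; exact hw)) - LinearMap.id
    have hinj : Function.Injective g := by
      rw [injective_iff_map_eq_zero]
      intro a ha
      exact hbar a (sub_eq_zero.mp ha)
    obtain ⟨q, hq⟩ := LinearMap.injective_iff_surjective.mp hinj (W.mkQ v)
    obtain ⟨u, rfl⟩ := W.mkQ_surjective q
    have h1 : v - (f u - u) ∈ W := by
      rw [← Submodule.Quotient.eq W]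
      exact hq.symm
    exact Submodule.mem_sup.mpr ⟨_, h1, f u - u, ⟨u, by simp⟩, by abel⟩
end

section
/- Under the stated hypotheses, the annihilator of W and the annihilator of range(f − id) are complementary subspaces of V*: their intersection is {0} and their sum is all of V* (IsCompl). -/
/-- Fiberwise decomposition of `M ×_X T*X` into the conormal bundle `T*_M X` and
the Lefschetz bundle: the annihilators of `W` and of `range (f - id)` are
complementary in `V*`. -/
theorem stmt6 (V : Type*) [AddCommGroup V] [Module ℝ V] [FiniteDimensional ℝ V]
    (f : V →ₗ[ℝ] V) (W : Submodule ℝ V) (hW : ∀ w ∈ W, f w = w)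
    (hbar : ∀ v : V ⧸ W,
      Submodule.mapQ W W f
        (fun w hw => Submodule.mem_comap.mpr (by rw [hW w hw]; exact hw)) v = v →
      v = 0) :
    IsCompl W.dualAnnihilator
      (LinearMap.range (f - LinearMap.id)).dualAnnihilator := by
  have key : ∀ v : V, f v - v ∈ W → v ∈ W := by
    intro v hv
    have h := hbar (Submodule.Quotient.mk v) (by
      rw [Submodule.mapQ_apply]
      exact (Submodule.Quotient.eq W).2 hv)
    exact (Submodule.Quotient.mk_eq_zero W).1 h
  apply Subspace.isCompl_dualAnnihilator
  constructor
  · rw [Submodule.disjoint_def]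
    rintro x hx ⟨v, rfl⟩
    have hv : v ∈ W := key v (by simpa using hx)
    simp [hW v hv]
  · rw [codisjoint_iff, eq_top_iff]
    intro v _
    let g := Submodule.mapQ W W f
        (fun w hw => Submodule.mem_comap.mpr (by rw [hW w hw]; exact hw)) - LinearMap.id
    have hinj : Function.Injective g := by
      rw [← LinearMap.ker_eq_bot, LinearMap.ker_eq_bot']
      intro m hm
      exact hbar m (sub_eq_zero.1 hm)
    have hsurj : Function.Surjective g := LinearMap.injective_iff_surjective.1 hinj
    obtain ⟨q, hq⟩ := hsurj (Submodule.Quotient.mk v)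
    obtain ⟨u, rfl⟩ := Submodule.Quotient.mk_surjective W q
    have hu : v - (f u - u) ∈ W := by
      rw [← Submodule.Quotient.eq W, ← hq]
      rfl
    rw [Submodule.mem_sup]
    exact ⟨_, hu, f u - u, ⟨u, rfl⟩, by abel⟩
end

section
/- Under the stated hypotheses, let additionally U ⊆ W be a subspace. Then the restriction map ρ : V* → W*, ξ ↦ ξ|_W, restricts to a linear isomorphism from the subspace {ξ ∈ V* : ξ vanishes on U and on range(f − id)} onto the annihilator {η ∈ W* : η vanishes on U} of U in W*. -/
/-- Fiberwise content of (4.25) in the proof of Lemma 4.8: for a subspace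
`U ⊆ W`, restriction to `W` maps the functionals annihilating both `U` and
`range (f - id)` isomorphically onto the annihilator of `U` in `W*`. -/
theorem stmt7 (V : Type*) [AddCommGroup V] [Module ℝ V] [FiniteDimensional ℝ V]
    (f : V →ₗ[ℝ] V) (W : Submodule ℝ V) (hW : ∀ w ∈ W, f w = w)
    (hbar : ∀ v : V ⧸ W,
      Submodule.mapQ W W f
        (fun w hw => Submodule.mem_comap.mpr (by rw [hW w hw]; exact hw)) v = v →
      v = 0)
    (U : Submodule ℝ V) (hU : U ≤ W) :
    Set.InjOn W.subtype.dualMap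
      ((U.dualAnnihilator ⊓
          (LinearMap.range (f - LinearMap.id)).dualAnnihilator :
        Submodule ℝ (Module.Dual ℝ V)) : Set (Module.Dual ℝ V)) ∧
    Submodule.map W.subtype.dualMap
        (U.dualAnnihilator ⊓
          (LinearMap.range (f - LinearMap.id)).dualAnnihilator)
      = (U.comap W.subtype).dualAnnihilator := by
  have key : ∀ v : V, f v - v ∈ W → v ∈ W := by
    intro v hv
    have h := hbar (Submodule.Quotient.mk v) (by
      rw [Submodule.mapQ_apply]
      exact (Submodule.Quotient.eq W).mpr hv)
    exact (Submodule.Quotient.mk_eq_zero W).mp h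
  have hker : LinearMap.ker (f - LinearMap.id) = W := by
    ext v
    rw [LinearMap.mem_ker, LinearMap.sub_apply, LinearMap.id_apply]
    constructor
    · intro h
      apply key
      rw [h]
      exact W.zero_mem
    · intro h
      rw [hW v h, sub_self]
  have hdis : Disjoint W (LinearMap.range (f - LinearMap.id)) := by
    rw [Submodule.disjoint_def]
    rintro _ hx ⟨v, rfl⟩
    rw [LinearMap.sub_apply, LinearMap.id_apply] at hx ⊢
    rw [hW v (key v hx), sub_self]
  have hcompl : IsCompl W (LinearMap.range (f - LinearMap.id)) := by
    refine ⟨hdis, codisjoint_iff.mpr (Submodule.eq_top_of_disjoint _ _ ?_ hdis)⟩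
    have h := LinearMap.finrank_range_add_finrank_ker (f - LinearMap.id)
    rw [hker] at h
    omega
  constructor
  · intro a ha b hb hab
    have ha2 := (Submodule.mem_dualAnnihilator _).mp ha.2
    have hb2 := (Submodule.mem_dualAnnihilator _).mp hb.2
    ext v
    have hv : v ∈ W ⊔ LinearMap.range (f - LinearMap.id) := by
      rw [hcompl.sup_eq_top]; trivial
    obtain ⟨w, hw, r, hr, rfl⟩ := Submodule.mem_sup.mp hv
    have h1 : a w = b w := LinearMap.congr_fun hab ⟨w, hw⟩
    rw [map_add, map_add, ha2 r hr, hb2 r hr, h1]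
  · ext η
    constructor
    · rintro ⟨ξ, hξ, rfl⟩
      rw [Submodule.mem_dualAnnihilator]
      intro w hw
      exact (Submodule.mem_dualAnnihilator _).mp hξ.1 _ hw
    · intro h
      rw [Submodule.mem_dualAnnihilator] at h
      refine ⟨LinearMap.ofIsCompl hcompl η 0, ⟨?_, ?_⟩, ?_⟩
      · refine (Submodule.mem_dualAnnihilator _).mpr fun u hu => ?_
        exact (LinearMap.ofIsCompl_left_apply hcompl (⟨u, hU hu⟩ : W)).trans (h _ hu)
      · refine (Submodule.mem_dualAnnihilator _).mpr fun r hr => ?_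
        exact LinearMap.ofIsCompl_right_apply hcompl
          (⟨r, hr⟩ : LinearMap.range (f - LinearMap.id))
      · ext w
        exact LinearMap.ofIsCompl_left_apply hcompl w
end

section
/- Fix natural numbers d and m and let S be a subset of (ℝ^d × ℝ^m) × (ℝ^d × ℝ^m) that is conic in the covector variables: for every t > 0, if (x', x'', ξ', ξ'') ∈ S then (x', x'', t·ξ', t·ξ'') ∈ S. Then the following two subsets of (ℝ^d × ℝ^m) × (ℝ^d × ℝ^m) coincide: (A) the set of (x', x'', ξ', ξ'') for which there exist sequences x'_n → x', x''_n → x'', ξ'_n → ξ', ξ''_n → ξ'' and positive reals t_n → 0 with (t_n·x'_n, x''_n, t_n⁻¹·ξ'_n, ξ''_n) ∈ S for all n; and (B) the set of (x', x'', ξ', ξ'') for which there exist a sequence (a'_n, a''_n, b'_n, b''_n) of points of S and positive reals c_n such that (a'_n, a''_n, b'_n, b''_n) → (0, x'', ξ', 0) and (c_n·a'_n, c_n·b''_n) → (x', ξ''). -/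
open Filter

lemma exists_scale {E : Type*} [NormedAddCommGroup E] [NormedSpace ℝ E] (v : ℕ → E) (c : ℕ → ℝ)
    (w : E) (hc : ∀ n, 0 < c n) (hv : Tendsto v atTop (nhds 0))
    (hw : Tendsto (fun n => c n • v n) atTop (nhds w)) :
    ∃ t : ℕ → ℝ, (∀ n, 0 < t n) ∧ Tendsto t atTop (nhds 0) ∧
      Tendsto (fun n => (t n)⁻¹ • v n) atTop (nhds w) := by
  by_cases h : w = 0
  · subst h
    have h1 : Tendsto (fun n => Real.sqrt ‖v n‖) atTop (nhds 0) := by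
      have := (Real.continuous_sqrt.tendsto _).comp hv.norm
      simpa [Function.comp_def] using this
    have hpos : ∀ n : ℕ, 0 < Real.sqrt ‖v n‖ + 1 / ((n : ℝ) + 1) := fun n => by positivity
    refine ⟨fun n => Real.sqrt ‖v n‖ + 1 / ((n : ℝ) + 1), hpos, ?_, ?_⟩
    · simpa using h1.add tendsto_one_div_add_atTop_nhds_zero_nat
    · refine squeeze_zero_norm (fun n => ?_) h1
      rw [norm_smul, norm_inv, Real.norm_of_nonneg (hpos n).le, inv_mul_le_iff₀ (hpos n)]
      have h2 := Real.mul_self_sqrt (norm_nonneg (v n))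
      have h3 : 0 ≤ 1 / ((n : ℝ) + 1) * Real.sqrt ‖v n‖ := by positivity
      nlinarith
  · refine ⟨fun n => (c n)⁻¹, fun n => inv_pos.2 (hc n), ?_, by simpa using hw⟩
    have h1 := hv.norm.div hw.norm (norm_ne_zero_iff.2 h)
    rw [norm_zero, zero_div] at h1
    refine h1.congr' ?_
    filter_upwards [hw.eventually_ne h] with n hn
    have hvn : ‖v n‖ ≠ 0 := by
      intro h0
      exact hn (by simp [norm_eq_zero.1 h0])
    have := (hc n).ne'
    simp only [Pi.div_apply, norm_smul, Real.norm_of_nonneg (hc n).le]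
    field_simp

/-- The set-theoretic identity (6.21)–(6.24) in the proof of Proposition 6.1:
for a set `S` conic in the covector variables, the support set arising from the
normal deformation coincides with the coordinate description of the normal cone
`C_{T*_M X}(SS(F))`. -/
theorem stmt13 (d m : ℕ)
    (S : Set ((Fin d → ℝ) × (Fin m → ℝ) × (Fin d → ℝ) × (Fin m → ℝ)))
    (hS : ∀ t : ℝ, 0 < t →
      ∀ x' : Fin d → ℝ, ∀ x'' : Fin m → ℝ, ∀ ξ' : Fin d → ℝ, ∀ ξ'' : Fin m → ℝ,
        (x', x'', ξ', ξ'') ∈ S → (x', x'', t • ξ', t • ξ'') ∈ S) :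
    {p : (Fin d → ℝ) × (Fin m → ℝ) × (Fin d → ℝ) × (Fin m → ℝ) |
      ∃ (x' : ℕ → Fin d → ℝ) (x'' : ℕ → Fin m → ℝ) (ξ' : ℕ → Fin d → ℝ)
        (ξ'' : ℕ → Fin m → ℝ) (t : ℕ → ℝ),
        (∀ n, 0 < t n) ∧
        Tendsto x' atTop (nhds p.1) ∧
        Tendsto x'' atTop (nhds p.2.1) ∧
        Tendsto ξ' atTop (nhds p.2.2.1) ∧
        Tendsto ξ'' atTop (nhds p.2.2.2) ∧
        Tendsto t atTop (nhds 0) ∧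
        ∀ n, (t n • x' n, x'' n, (t n)⁻¹ • ξ' n, ξ'' n) ∈ S} =
    {p : (Fin d → ℝ) × (Fin m → ℝ) × (Fin d → ℝ) × (Fin m → ℝ) |
      ∃ (a : ℕ → (Fin d → ℝ) × (Fin m → ℝ) × (Fin d → ℝ) × (Fin m → ℝ))
        (c : ℕ → ℝ),
        (∀ n, a n ∈ S) ∧ (∀ n, 0 < c n) ∧
        Tendsto a atTop (nhds (0, p.2.1, p.2.2.1, 0)) ∧
        Tendsto (fun n => (c n • (a n).1, c n • (a n).2.2.2)) atTop
          (nhds (p.1, p.2.2.2))} := by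
  ext p
  simp only [Set.mem_setOf_eq]
  constructor
  · rintro ⟨x', x'', ξ', ξ'', t, ht, h1, h2, h3, h4, h5, hm⟩
    refine ⟨fun n => (t n • x' n, x'' n, ξ' n, t n • ξ'' n), fun n => (t n)⁻¹, fun n => ?_,
      fun n => inv_pos.2 (ht n), ?_, ?_⟩
    · have := hS (t n) (ht n) _ _ _ _ (hm n)
      rwa [smul_inv_smul₀ (ht n).ne'] at this
    · have e1 := h5.smul h1
      have e4 := h5.smul h4
      rw [zero_smul] at e1 e4
      exact e1.prodMk_nhds (h2.prodMk_nhds (h3.prodMk_nhds e4))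
    · simp only [inv_smul_smul₀ (ht _).ne']
      exact h1.prodMk_nhds h4
  · rintro ⟨a, c, ha, hc, h1, h2⟩
    have g1 := h1.fst_nhds
    have g2 := h1.snd_nhds.fst_nhds
    have g3 := h1.snd_nhds.snd_nhds.fst_nhds
    have g4 := h1.snd_nhds.snd_nhds.snd_nhds
    obtain ⟨t, ht, ht0, hw⟩ := exists_scale (fun n => ((a n).1, (a n).2.2.2)) c
      (p.1, p.2.2.2) hc (g1.prodMk_nhds g4) h2
    refine ⟨fun n => (t n)⁻¹ • (a n).1, fun n => (a n).2.1, fun n => (a n).2.2.1,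
      fun n => (t n)⁻¹ • (a n).2.2.2, t, ht, hw.fst_nhds, g2, g3, hw.snd_nhds, ht0, fun n => ?_⟩
    rw [smul_inv_smul₀ (ht n).ne']
    exact hS _ (inv_pos.2 (ht n)) _ _ _ _ (ha n)
end
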